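/- Let F_q be a finite field of odd order q, let t ∈ F_q with t ≠ 0, and let U, V ⊆ F_q^2. Then |N_t(U,V) − |U||V|/q| ≤ 2 q^{1/2} (|U||V|)^{1/2}. -/

import Mathlib

open Finset

/-- `‖x‖ = x₁² + x₂²` for `x ∈ F_q²`. -/
def nrm {F : Type} [Field F] (x : F × F) : F := x.1 ^ 2 + x.2 ^ 2

/-- `N_t(U,V)`: number of pairs `(u,v) ∈ U × V` with `‖u - v‖ = t`. -/
def nDist {F : Type} [Field F] [DecidableEq F] (t : F)
    (U V : Finset (F × F)) : ℕ :=
  ((U ×ˢ V).filter (fun p => nrm (p.1 - p.2) = t)).card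

theorem kl_exists_valued (K : Type) [Field K] (q : ℕ) (hq : 2 ≤ q) (a e : K) :
    ∃ (L : Type) (_ : Field L) (_ : Algebra K L) (Γ : Type) (_ : LinearOrderedCommGroupWithZero Γ)
      (v : Valuation L Γ) (x w : L) (γ : Γ), 1 < γ ∧ v x = γ ^ q ∧ v w = γ ^ (q + 1) ∧
      (∀ c : K, c ≠ 0 → v (algebraMap K L c) = 1) ∧
      w ^ q = x ^ (q - 1) * w + x ^ (q + 1) - algebraMap K L e * x ^ q
        + algebraMap K L a * x ^ (q - 1) := by
  let L := AlgebraicClosure (RatFunc K)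
  let φ : Polynomial K →+* L := algebraMap (Polynomial K) L
  have hφ : Function.Injective φ := by
    have h1 : φ = (algebraMap (RatFunc K) L).comp (algebraMap (Polynomial K) (RatFunc K)) :=
      IsScalarTower.algebraMap_eq _ _ _
    rw [h1]
    exact (algebraMap (RatFunc K) L).injective.comp (RatFunc.algebraMap_injective K)
  have hcomp : ∀ c : K, φ (Polynomial.C c) = algebraMap K L c := by
    intro c
    exact (IsScalarTower.algebraMap_apply K (Polynomial K) L c).symm
  let A : Subring L := φ.range
  let t : A := ⟨φ Polynomial.X, ⟨_, rfl⟩⟩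
  have hI : Ideal.span {t} ≠ ⊤ := by
    intro h
    rw [Ideal.span_singleton_eq_top] at h
    obtain ⟨⟨u, f, rfl⟩, hu⟩ := h.exists_right_inv
    have h2 : φ (Polynomial.X * f) = φ 1 := by
      rw [map_mul, map_one]
      exact congrArg Subtype.val hu
    have h3 := hφ h2
    have := congrArg (Polynomial.eval 0) h3
    simp at this
  obtain ⟨V, hAV, hIV⟩ := Ideal.image_subset_nonunits_valuationSubring _ hI
  have ht : φ Polynomial.X ∈ V.nonunits := hIV ⟨t, Ideal.subset_span rfl, rfl⟩
  rw [ValuationSubring.mem_nonunits_iff] at ht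
  let v := V.valuation
  have hle : ∀ c : K, v (algebraMap K L c) ≤ 1 := by
    intro c
    rw [ValuationSubring.valuation_le_one_iff]
    exact hAV ⟨Polynomial.C c, hcomp c⟩
  have hone : ∀ c : K, c ≠ 0 → v (algebraMap K L c) = 1 := by
    intro c hc
    apply le_antisymm (hle c)
    have h1 := hle c⁻¹
    rw [map_inv₀, map_inv₀] at h1
    have hne : v (algebraMap K L c) ≠ 0 := by simpa using hc
    rwa [inv_le_one₀ (zero_lt_iff.2 hne)] at h1
  have ht0 : φ Polynomial.X ≠ 0 := by
    intro h
    exact Polynomial.X_ne_zero (hφ (by rw [h, map_zero]))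
  set x : L := (φ Polynomial.X)⁻¹ with hxdef
  have hx0 : x ≠ 0 := inv_ne_zero ht0
  have hvx : 1 < v x := by
    rw [hxdef, map_inv₀]
    exact (one_lt_inv₀ (zero_lt_iff.2 (by simpa using ht0))).2 ht
  set f : L := x + algebraMap K L a / x - algebraMap K L e with hf
  have hvf : v f = v x := by
    rw [hf, add_sub_assoc]
    apply Valuation.map_add_eq_of_lt_left
    refine lt_of_le_of_lt (Valuation.map_sub _ _ _) (max_lt ?_ ((hle e).trans_lt hvx))
    rw [map_div₀]
    refine lt_of_le_of_lt (div_le_one_of_le₀ ((hle a).trans hvx.le) zero_le) hvx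
  obtain ⟨y, hy⟩ : ∃ y : L, y ^ q - y = f := by
    have hdeg : (Polynomial.X ^ q - (Polynomial.X + Polynomial.C f) : Polynomial L).degree = q := by
      rw [Polynomial.degree_sub_eq_left_of_degree_lt, Polynomial.degree_X_pow]
      rw [Polynomial.degree_X_add_C, Polynomial.degree_X_pow]
      exact_mod_cast hq
    obtain ⟨y, hy⟩ := IsAlgClosed.exists_root _ (by rw [hdeg]; exact_mod_cast (by omega : q ≠ 0))
    refine ⟨y, ?_⟩
    simp [Polynomial.IsRoot] at hy
    linear_combination hy
  have hvy : 1 < v y := by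
    by_contra! h
    have : v (y ^ q - y) ≤ 1 := by
      refine (Valuation.map_sub _ _ _).trans (max_le ?_ h)
      rw [map_pow]; exact pow_le_one' h _
    rw [hy, hvf] at this
    exact absurd hvx (not_lt.2 this)
  have hvq : v x = v y ^ q := by
    rw [← hvf, ← hy, sub_eq_add_neg, ← map_pow]
    apply Valuation.map_add_eq_of_lt_left
    rw [Valuation.map_neg, map_pow]
    exact lt_self_pow₀ hvy (by omega)
  refine ⟨L, inferInstance, inferInstance, _, inferInstance, v, x, x * y, v y, hvy, hvq, ?_, hone, ?_⟩
  · rw [map_mul, hvq, pow_succ]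
  · rw [mul_pow, show y ^ q = y + f by rw [← hy]; ring, hf]
    obtain ⟨k, rfl⟩ : ∃ k, q = k + 1 := ⟨q - 1, by omega⟩
    simp only [Nat.add_sub_cancel]
    have h1 : x * (algebraMap K L a / x) = algebraMap K L a := mul_div_cancel₀ _ hx0
    linear_combination x ^ k * h1

/-- reduced monomial of weight `n` -/
def klMon {B : Type} [CommRing B] (q : ℕ) (x w : B) (n : ℕ) : B :=
  x ^ (n / q - n % q) * w ^ (n % q)

def klSpan (K : Type) {B : Type} [Field K] [CommRing B] [Algebra K B] (q : ℕ) (x w : B) (k : ℕ) :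
    Submodule K B := Submodule.span K (Set.range fun n : Fin (k + 1) => klMon q x w n)

theorem klSpan_mem {K B : Type} [Field K] [CommRing B] [Algebra K B] (q : ℕ) (hq : 2 ≤ q) (a e : K)
    (x w : B) (hrel : w ^ q = x ^ (q - 1) * w + x ^ (q + 1) - algebraMap K B e * x ^ q
        + algebraMap K B a * x ^ (q - 1)) (k : ℕ) (i : ℕ) :
    ∀ j, q * j + (q + 1) * i ≤ k → x ^ j * w ^ i ∈ klSpan K q x w k := by
  induction i using Nat.strong_induction_on with
  | _ i ih =>
  intro j hj
  by_cases hi : i < q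
  · refine Submodule.subset_span ⟨⟨q * j + (q + 1) * i, by omega⟩, ?_⟩
    have h1 : (q * j + (q + 1) * i) = i + q * (j + i) := by ring
    have h2 : (q * j + (q + 1) * i) % q = i := by
      rw [h1, Nat.add_mul_mod_self_left, Nat.mod_eq_of_lt hi]
    have h3 : (q * j + (q + 1) * i) / q = j + i := by
      rw [h1, Nat.add_mul_div_left _ _ (by omega), Nat.div_eq_of_lt hi, zero_add]
    simp only [klMon, h2, h3, Nat.add_sub_cancel]
  · obtain ⟨i', rfl⟩ : ∃ i', i = i' + q := ⟨i - q, by omega⟩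
    have key : x ^ j * w ^ (i' + q) = x ^ (j + (q - 1)) * w ^ (i' + 1) + x ^ (j + (q + 1)) * w ^ i'
        - e • (x ^ (j + q) * w ^ i') + a • (x ^ (j + (q - 1)) * w ^ i') := by
      rw [pow_add w i' q, hrel, Algebra.smul_def, Algebra.smul_def]
      ring
    rw [key]
    have e1 : q * (q - 1) + q = q * q := by
      obtain ⟨m, rfl⟩ : ∃ m, q = m + 1 := ⟨q - 1, by omega⟩
      simp only [Nat.add_sub_cancel]; ring
    refine Submodule.add_mem _ (Submodule.sub_mem _ (Submodule.add_mem _ ?_ ?_)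
      (Submodule.smul_mem _ _ ?_)) (Submodule.smul_mem _ _ ?_)
    · exact ih _ (by omega) _ (by nlinarith)
    · exact ih _ (by omega) _ (by nlinarith)
    · exact ih _ (by omega) _ (by nlinarith)
    · exact ih _ (by omega) _ (by nlinarith)

theorem klSpan_extract {K B : Type} [Field K] [CommRing B] [Algebra K B] (q : ℕ) (hq : 2 ≤ q)
    (x w : B) (k : ℕ) (z : B) (hz : z ∈ klSpan K q x w k) :
    ∃ p : ℕ → Polynomial K, (∀ i, q * (p i).natDegree ≤ k) ∧
      z = ∑ i ∈ range q, Polynomial.aeval x (p i) * w ^ i := by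
  induction hz using Submodule.span_induction with
  | mem z hz =>
    obtain ⟨n, rfl⟩ := hz
    refine ⟨fun i => if i = n % q then Polynomial.X ^ (n / q - n % q) else 0, ?_, ?_⟩
    · intro i
      dsimp only
      split_ifs
      · rw [Polynomial.natDegree_X_pow]
        have h1 := Nat.div_mul_le_self n q
        have h2 : q * (n / q - n % q) ≤ q * (n / q) := Nat.mul_le_mul_left _ (Nat.sub_le _ _)
        have := n.2
        nlinarith
      · simp
    · rw [Finset.sum_eq_single (n % q : ℕ)]
      · simp [klMon]
      · intro b _ hb
        simp [hb]
      · intro h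
        exact absurd (Finset.mem_range.2 (Nat.mod_lt _ (by omega))) h
  | zero => exact ⟨0, by simp, by simp⟩
  | add z z' _ _ h h' =>
    obtain ⟨p, hp, rfl⟩ := h
    obtain ⟨p', hp', rfl⟩ := h'
    refine ⟨p + p', fun i => ?_, ?_⟩
    · have := Polynomial.natDegree_add_le (p i) (p' i)
      rcases le_max_iff.1 this with h | h
      · exact (Nat.mul_le_mul_left _ h).trans (hp i)
      · exact (Nat.mul_le_mul_left _ h).trans (hp' i)
    · rw [← Finset.sum_add_distrib]
      exact Finset.sum_congr rfl fun i _ => by simp [add_mul]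
  | smul c z _ h =>
    obtain ⟨p, hp, rfl⟩ := h
    refine ⟨c • p, fun i => (Nat.mul_le_mul_left _ (Polynomial.natDegree_smul_le _ _)).trans (hp i), ?_⟩
    rw [Finset.smul_sum]
    exact Finset.sum_congr rfl fun i _ => by simp

theorem klMon_rel_mem {K B : Type} [Field K] [CommRing B] [Algebra K B] (q : ℕ) (hq : 2 ≤ q) (a e : K)
    (x w : B) (hrel : w ^ q = x ^ (q - 1) * w + x ^ (q + 1) - algebraMap K B e * x ^ q
        + algebraMap K B a * x ^ (q - 1)) (r m n k : ℕ) (hm : q ^ 2 ≤ m) (hn : q ^ 2 ≤ n)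
    (hk : r * m + n ≤ k) :
    klMon q x w m ^ r * klMon q x w n ∈ klSpan K q x w k := by
  have aux : ∀ m, q ^ 2 ≤ m → q * (m / q - m % q) + (q + 1) * (m % q) = m := by
    intro m hm
    have h1 : q ≤ m / q := (Nat.le_div_iff_mul_le (by omega)).2 (by nlinarith)
    have h2 : m % q < q := Nat.mod_lt _ (by omega)
    have h3 := Nat.div_add_mod m q
    obtain ⟨d, hd⟩ : ∃ d, m / q = d + m % q := ⟨m / q - m % q, by omega⟩
    rw [hd, Nat.add_sub_cancel]
    rw [hd] at h3
    nlinarith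
  have e1 := aux m hm
  have e2 := aux n hn
  have : klMon q x w m ^ r * klMon q x w n
    = x ^ ((m / q - m % q) * r + (n / q - n % q)) * w ^ (m % q * r + n % q) := by
    simp only [klMon]; ring
  rw [this]
  apply klSpan_mem q hq a e x w hrel
  calc _ = r * (q * (m / q - m % q) + (q + 1) * (m % q)) + (q * (n / q - n % q) + (q + 1) * (n % q)) := by ring
    _ = r * m + n := by rw [e1, e2]
    _ ≤ k := hk

theorem klMon_val {L Γ : Type} [Field L] [LinearOrderedCommGroupWithZero Γ] (v : Valuation L Γ)
    (x w : L) (γ : Γ) (q : ℕ) (hq : 2 ≤ q) (hx : v x = γ ^ q) (hw : v w = γ ^ (q + 1)) (m : ℕ)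
    (hm : q ^ 2 ≤ m) : v (klMon q x w m) = γ ^ m := by
  have aux : q * (m / q - m % q) + (q + 1) * (m % q) = m := by
    have h1 : q ≤ m / q := (Nat.le_div_iff_mul_le (by omega)).2 (by nlinarith)
    have h2 : m % q < q := Nat.mod_lt _ (by omega)
    have h3 := Nat.div_add_mod m q
    obtain ⟨d, hd⟩ : ∃ d, m / q = d + m % q := ⟨m / q - m % q, by omega⟩
    rw [hd, Nat.add_sub_cancel]
    rw [hd] at h3
    nlinarith
  rw [klMon, map_mul, map_pow, map_pow, hx, hw, ← pow_mul, ← pow_mul, ← pow_add, aux]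

theorem kl_val_ne {L Γ ι : Type} [Field L] [LinearOrderedCommGroupWithZero Γ] [Fintype ι]
    (v : Valuation L Γ) (γ : Γ) (hγ : 1 < γ) (f : ι → L) (wt : ι → ℕ)
    (hinj : Function.Injective wt) (hf : ∀ i, f i = 0 ∨ v (f i) = γ ^ wt i) (hne : ∃ i, f i ≠ 0) :
    ∑ i, f i ≠ 0 := by
  classical
  obtain ⟨i0, hi0⟩ := hne
  obtain ⟨j, hj, hmax⟩ := Finset.exists_max_image (univ.filter fun i => f i ≠ 0) wt
    ⟨i0, by simp [hi0]⟩
  have hj' : f j ≠ 0 := by simpa using hj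
  have hγ0 : γ ≠ 0 := (zero_lt_one.trans hγ).ne'
  have h2 : v (∑ i, f i) = v (f j) := by
    apply Valuation.map_sum_eq_of_lt
    · exact mem_univ j
    · intro i hi
      have hij : i ≠ j := by simpa using hi
      rcases hf i with h | h
      · rw [h, map_zero]; exact zero_lt_iff.2 (by simpa using hj')
      · rw [h, (hf j).resolve_left hj']
        apply pow_lt_pow_right₀ hγ
        refine lt_of_le_of_ne (hmax i ?_) (fun h => hij (hinj h))
        simp only [mem_filter, mem_univ, true_and]
        intro h0
        rw [h0, map_zero] at h
        exact pow_ne_zero _ hγ0 h.symm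
  intro h0
  rw [h0, map_zero] at h2
  exact hj' (by simpa using h2.symm)

theorem kl_stepanov (K : Type) [Field K] [Fintype K] [DecidableEq K] (p k j q r : ℕ) [Fact p.Prime]
    [CharP K p] (hr : r = p ^ k) (hqp : q = p ^ j) (hK : Fintype.card K = r ^ 2) (hq : 2 ≤ q)
    (hbig : q ^ 7 ≤ r) (a e : K) (Z : Finset K) (hZ : #Z = q) (hZ0 : ∀ c ∈ Z, c ^ q = c)
    (X : Finset K) (hX : ∀ x ∈ X, x ≠ 0 ∧ ∃ y, y ^ q - y = x + a / x - e) :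
    q * #X ≤ r ^ 2 + (2 * q ^ 2 + 3) * r := by
  have hsum : ∀ (κ : Type) (s : Finset κ) (f : κ → K), (∑ i ∈ s, f i) ^ r = ∑ i ∈ s, f i ^ r := by
    intro κ s f
    rw [hr, sum_pow_char_pow p k]
  obtain ⟨L, _, _, Γ, _, v, xL, wL, γ, hγ, hvx, hvw, hvc, hrelL⟩ := kl_exists_valued K q hq a e
  let P := {z : K × K // z.1 ≠ 0 ∧ z.2 ^ q - z.2 = z.1 + a / z.1 - e}
  let B := (P → K) × L
  let x : B := (fun z => z.1.1, xL)
  let w : B := (fun z => z.1.1 * z.1.2, wL)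
  have hrel : w ^ q = x ^ (q - 1) * w + x ^ (q + 1) - algebraMap K B e * x ^ q
        + algebraMap K B a * x ^ (q - 1) := by
    refine Prod.ext ?_ hrelL
    funext z
    obtain ⟨⟨x0, y0⟩, hx0, hy⟩ := z
    change (x0 * y0) ^ q = x0 ^ (q - 1) * (x0 * y0) + x0 ^ (q + 1) - e * x0 ^ q + a * x0 ^ (q - 1)
    simp only at hx0 hy
    rw [mul_pow, show y0 ^ q = y0 + (x0 + a / x0 - e) by rw [← hy]; ring]
    obtain ⟨k, rfl⟩ : ∃ k, q = k + 1 := ⟨q - 1, by omega⟩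
    simp only [Nat.add_sub_cancel]
    have h1 : x0 * (a / x0) = a := mul_div_cancel₀ _ hx0
    linear_combination x0 ^ k * h1
  have hq2 : q ^ 4 ≤ r := (Nat.pow_le_pow_right (by omega) (by norm_num)).trans hbig
  have hq7 : 8 * q ^ 4 ≤ r := by
    calc 8 * q ^ 4 ≤ q ^ 3 * q ^ 4 := Nat.mul_le_mul_right _ (by
          calc 8 = 2 ^ 3 := by norm_num
            _ ≤ q ^ 3 := Nat.pow_le_pow_left hq 3)
      _ = q ^ 7 := by ring
      _ ≤ r := hbig
  have hq24 : 4 * q ^ 2 ≤ q ^ 4 := by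
    have : 4 ≤ q ^ 2 := by nlinarith
    nlinarith
  have hq4 : 4 ≤ q ^ 2 := by nlinarith
  let ι := Fin (r - q ^ 2) × Fin (r + q ^ 2 + 2)
  let α : ι → ℕ := fun i => q ^ 2 + i.1
  let β : ι → ℕ := fun i => q ^ 2 + i.2
  have hα : ∀ i, α i < r := fun i => by have := i.1.2; simp only [α]; omega
  have hβ : ∀ i, β i ≤ r + 2 * q ^ 2 + 1 := fun i => by have := i.2.2; simp only [β]; omega
  have hαq : ∀ i, q ^ 2 ≤ α i := fun i => Nat.le_add_right _ _
  have hβq : ∀ i, q ^ 2 ≤ β i := fun i => Nat.le_add_right _ _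
  -- the linear system
  let T : ι → B := fun i => klMon q x w (α i) ^ r * klMon q x w (β i)
  let k0 := r ^ 2 + 2 * q ^ 2 + 1
  have hT : ∀ i, T i ∈ klSpan K q x w k0 := by
    intro i
    apply klMon_rel_mem q hq a e x w hrel r _ _ _ (hαq i) (hβq i)
    have h1 := hα i
    have h2 := hβ i
    have h3 : r * α i + r ≤ r * r := by
      calc r * α i + r = r * (α i + 1) := by ring
        _ ≤ r * r := Nat.mul_le_mul_left _ h1
    simp only [k0]
    nlinarith
  let Ψ : (ι → K) →ₗ[K] klSpan K q x w k0 :=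
    Fintype.linearCombination K (fun i => (⟨T i, hT i⟩ : klSpan K q x w k0))
  have : FiniteDimensional K (klSpan K q x w k0) :=
    FiniteDimensional.span_of_finite K (Set.finite_range _)
  have hfr : Module.finrank K (klSpan K q x w k0) < Module.finrank K (ι → K) := by
    have h1 : Module.finrank K (klSpan K q x w k0) ≤ k0 + 1 := by
      have := finrank_range_le_card (R := K) (fun n : Fin (k0 + 1) => klMon q x w n)
      rwa [Fintype.card_fin] at this
    refine lt_of_le_of_lt h1 ?_
    rw [Module.finrank_fintype_fun_eq_card, Fintype.card_prod, Fintype.card_fin, Fintype.card_fin]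
    obtain ⟨d, hd⟩ : ∃ d, r = d + q ^ 2 := ⟨r - q ^ 2, by omega⟩
    simp only [k0]
    rw [hd, Nat.add_sub_cancel]
    have : 8 * q ^ 4 ≤ d + q ^ 2 := hd ▸ hq7
    nlinarith
  obtain ⟨c, hc, hc0⟩ := (Submodule.ne_bot_iff _).1 (LinearMap.ker_ne_bot_of_finrank_lt (f := Ψ) hfr)
  have hE : ∑ i, c i • T i = 0 := by
    have h1 : Ψ c = 0 := hc
    have h2 := congrArg Subtype.val h1
    simpa [Ψ, Fintype.linearCombination_apply] using h2
  -- the auxiliary function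
  let S : ι → B := fun i => klMon q x w (β i) ^ r * klMon q x w (α i)
  let k1 := r ^ 2 + (2 * q ^ 2 + 3) * r
  have hS : ∀ i, S i ∈ klSpan K q x w k1 := by
    intro i
    apply klMon_rel_mem q hq a e x w hrel r _ _ _ (hβq i) (hαq i)
    have h1 := hα i
    have h3 : r * β i ≤ r * (r + 2 * q ^ 2 + 1) := Nat.mul_le_mul_left _ (hβ i)
    simp only [k1]
    nlinarith
  set h : B := ∑ i, (c i ^ r) • S i with hh
  have hmem : h ∈ klSpan K q x w k1 :=
    Submodule.sum_mem _ fun i _ => Submodule.smul_mem _ _ (hS i)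
  have hr0 : 0 < r := by
    have : 0 < q ^ 2 := by positivity
    omega
  have hne : h ≠ 0 := by
    intro h0
    have h1 : h.2 = 0 := by rw [h0]; rfl
    have h2 : h.2 = ∑ i, (c i ^ r) • (klMon q xL wL (β i) ^ r * klMon q xL wL (α i)) := by
      rw [hh, Prod.snd_sum]
      rfl
    rw [h2] at h1
    have hv : ∀ i, v (klMon q xL wL (β i) ^ r * klMon q xL wL (α i)) = γ ^ (β i * r + α i) := by
      intro i
      rw [map_mul, map_pow, klMon_val v xL wL γ q hq hvx hvw _ (hβq i),
        klMon_val v xL wL γ q hq hvx hvw _ (hαq i), ← pow_mul, ← pow_add]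
    have hγ0 : γ ≠ 0 := (zero_lt_one.trans hγ).ne'
    refine kl_val_ne v γ hγ _ (fun i => β i * r + α i) ?_ ?_ ?_ h1
    · intro i i' hii
      simp only at hii
      have e1 : α i = α i' := by
        have := congrArg (· % r) hii
        simpa [Nat.add_mod, Nat.mod_eq_of_lt (hα i), Nat.mod_eq_of_lt (hα i')] using this
      have e2 : β i = β i' := by
        rw [e1] at hii
        exact Nat.eq_of_mul_eq_mul_right hr0 (Nat.add_right_cancel hii)
      refine Prod.ext (Fin.ext ?_) (Fin.ext ?_)
      · exact Nat.add_left_cancel e1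
      · exact Nat.add_left_cancel e2
    · intro i
      by_cases hci : c i = 0
      · left; rw [hci, zero_pow hr0.ne', zero_smul]
      · right
        rw [Algebra.smul_def, map_mul, hvc _ (pow_ne_zero _ hci), one_mul, hv]
    · obtain ⟨i, hi⟩ := Function.ne_iff.1 hc0
      refine ⟨i, ?_⟩
      rw [← (v.ne_zero_iff), Algebra.smul_def, map_mul, hvc _ (pow_ne_zero _ hi), one_mul, hv]
      exact pow_ne_zero _ hγ0
  -- vanishing at points
  have hvan : ∀ z : P, h.1 z = 0 := by
    intro z
    have key : (h.1 z) ^ r = 0 := by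
      have h1 : h.1 z = ∑ i, (c i ^ r) * (klMon q z.1.1 (z.1.1 * z.1.2) (β i) ^ r
          * klMon q z.1.1 (z.1.1 * z.1.2) (α i)) := by
        rw [hh, Prod.fst_sum, Finset.sum_apply]
        rfl
      have h2 : ∑ i, (c i) * (klMon q z.1.1 (z.1.1 * z.1.2) (α i) ^ r
          * klMon q z.1.1 (z.1.1 * z.1.2) (β i)) = 0 := by
        have := congrFun (congrArg Prod.fst hE) z
        rw [Prod.fst_sum, Finset.sum_apply] at this
        exact this
      have hfrob : ∀ u : K, (u ^ r) ^ r = u := by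
        intro u
        rw [← pow_mul, ← sq, ← hK, FiniteField.pow_card]
      rw [h1, hsum]
      refine Eq.trans ?_ h2
      refine Finset.sum_congr rfl fun i _ => ?_
      rw [mul_pow, mul_pow, hfrob, hfrob]
      ring
    exact pow_eq_zero_iff hr0.ne' |>.1 key
  obtain ⟨f, hfdeg, hf⟩ := klSpan_extract q hq x w k1 h hmem
  obtain ⟨i0, hi0, hfi0⟩ : ∃ i ∈ range q, f i ≠ 0 := by
    by_contra! hcon
    apply hne
    rw [hf]
    exact Finset.sum_eq_zero fun i hi => by rw [hcon i hi]; simp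
  have hroot : ∀ x0 ∈ X, (f i0).IsRoot x0 := by
    intro x0 hx0
    obtain ⟨hx00, y0, hy0⟩ := hX x0 hx0
    let g : Polynomial K := ∑ i ∈ range q, Polynomial.C ((f i).eval x0) * Polynomial.X ^ i
    have hgdeg : g.degree < q := by
      refine (Polynomial.degree_sum_le _ _).trans_lt ?_
      rw [Finset.sup_lt_iff (by exact_mod_cast WithBot.bot_lt_coe q)]
      intro i hi
      refine (Polynomial.degree_C_mul_X_pow_le _ _).trans_lt ?_
      exact_mod_cast Finset.mem_range.1 hi
    have hgz : ∀ c ∈ Z, g.eval (x0 * (y0 + c)) = 0 := by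
      intro c hc
      let z : P := ⟨(x0, y0 + c), hx00, by
        simp only
        rw [← hy0, hqp, add_pow_char_pow, ← hqp, hZ0 c hc]; ring⟩
      have h1 := hvan z
      rw [hf, Prod.fst_sum, Finset.sum_apply] at h1
      rw [Polynomial.eval_finsetSum, ← h1]
      refine Finset.sum_congr rfl fun i _ => ?_
      simp only [Polynomial.eval_mul, Polynomial.eval_C, Polynomial.eval_pow, Polynomial.eval_X]
      let ev : B →ₐ[K] K := (Pi.evalAlgHom K (fun _ : P => K) z).comp (AlgHom.fst K (P → K) L)
      change _ = ev (Polynomial.aeval x (f i) * w ^ i)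
      rw [map_mul, map_pow, ← Polynomial.aeval_algHom_apply]
      rfl
    have hg0 : g = 0 := by
      refine Polynomial.eq_zero_of_degree_lt_of_eval_finset_eq_zero
        (Z.image fun c => x0 * (y0 + c)) ?_ ?_
      · rw [Finset.card_image_of_injective, hZ]
        · exact hgdeg
        · intro c c' hcc
          exact add_left_cancel (mul_left_cancel₀ hx00 hcc)
      · intro u hu
        obtain ⟨c, hc, rfl⟩ := Finset.mem_image.1 hu
        exact hgz c hc
    have h3 := congrArg (fun P => Polynomial.coeff P i0) hg0
    simp only [g, Polynomial.finsetSum_coeff, Polynomial.coeff_C_mul, Polynomial.coeff_X_pow,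
      Polynomial.coeff_zero, mul_ite, mul_one, mul_zero] at h3
    rw [Finset.sum_ite_eq] at h3
    simpa [hi0] using h3
  have hcard : #X ≤ (f i0).natDegree := by
    calc #X ≤ #((f i0).roots.toFinset) := Finset.card_le_card fun x0 hx0 => by
          rw [Multiset.mem_toFinset, Polynomial.mem_roots hfi0]; exact hroot x0 hx0
      _ ≤ (f i0).roots.card := Multiset.toFinset_card_le _
      _ ≤ _ := Polynomial.card_roots' _
  exact (Nat.mul_le_mul_left _ hcard).trans (hfdeg i0)

theorem kl_hilbert90 (F K : Type) [Field F] [Fintype F] [Field K] [Fintype K] [Algebra F K]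
    (z : K) (hz : Algebra.trace F K z = 0) : ∃ y : K, y ^ Fintype.card F - y = z := by
  classical
  let φ : K →ₗ[F] K := (FiniteField.frobeniusAlgEquivOfAlgebraic F K).toLinearMap - LinearMap.id
  have hφ : ∀ y, φ y = y ^ Fintype.card F - y := fun y => by simp [φ]
  have hle : LinearMap.range φ ≤ LinearMap.ker (Algebra.trace F K) := by
    rintro _ ⟨y, rfl⟩
    rw [LinearMap.mem_ker]
    simp only [φ, LinearMap.sub_apply, LinearMap.id_apply, map_sub]
    rw [sub_eq_zero]
    exact Algebra.trace_eq_of_algEquiv _ _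
  have hker : Module.finrank F (LinearMap.ker φ) ≤ 1 := by
    have h1 : Fintype.card (LinearMap.ker φ) = Fintype.card F ^ Module.finrank F (LinearMap.ker φ) :=
      Module.card_eq_pow_finrank
    have h2 : Fintype.card (LinearMap.ker φ) ≤ Fintype.card F := by
      have hP : (Polynomial.X ^ Fintype.card F - Polynomial.X : Polynomial K) ≠ 0 :=
        FiniteField.X_pow_card_sub_X_ne_zero K Fintype.one_lt_card
      calc Fintype.card (LinearMap.ker φ)
          = #(univ.image (fun y : LinearMap.ker φ => (y : K))) := by
            rw [Finset.card_image_of_injective _ Subtype.val_injective, Finset.card_univ]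
        _ ≤ #((Polynomial.X ^ Fintype.card F - Polynomial.X : Polynomial K).roots.toFinset) := by
            apply Finset.card_le_card
            intro y hy
            obtain ⟨⟨y, hy'⟩, _, rfl⟩ := Finset.mem_image.1 hy
            rw [Multiset.mem_toFinset, Polynomial.mem_roots hP]
            rw [LinearMap.mem_ker, hφ] at hy'
            simpa [Polynomial.IsRoot] using hy'
        _ ≤ _ := (Multiset.toFinset_card_le _).trans (Polynomial.card_roots' _)
        _ = Fintype.card F := FiniteField.X_pow_card_sub_X_natDegree_eq K Fintype.one_lt_card
    rw [h1] at h2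
    by_contra! h
    have : Fintype.card F ^ 1 < Fintype.card F ^ Module.finrank F (LinearMap.ker φ) :=
      Nat.pow_lt_pow_right Fintype.one_lt_card h
    rw [pow_one] at this
    omega
  have hr1 := LinearMap.finrank_range_add_finrank_ker φ
  have hr2 := LinearMap.finrank_range_add_finrank_ker (Algebra.trace F K)
  have hr3 : Module.finrank F (LinearMap.range (Algebra.trace F K)) = 1 := by
    rw [LinearMap.range_eq_top.2 (Algebra.trace_surjective F K), finrank_top, Module.finrank_self]
  have heq := Submodule.eq_of_le_of_finrank_le hle (by omega)
  have : z ∈ LinearMap.range φ := by rw [heq]; exact hz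
  obtain ⟨y, hy⟩ := this
  exact ⟨y, by rw [← hφ, hy]⟩

theorem kl_ext_bound (F K : Type) [Field F] [Fintype F] [Field K] [Fintype K] [DecidableEq K]
    [Algebra F K] (m : ℕ) (hm : 7 ≤ m) (hfin : Module.finrank F K = 2 * m) (ψ : AddChar F ℂ)
    (hψ : ψ ≠ 1) (a : F) :
    ‖∑ x ∈ univ.filter (fun x : K => x ≠ 0), ψ (Algebra.trace F K (x + algebraMap F K a / x))‖
      ≤ (4 * (Fintype.card F : ℝ) ^ 2 + 7) * (Fintype.card F : ℝ) ^ m := by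
  classical
  obtain ⟨p, hp⟩ := CharP.exists F
  have hpp : Fact p.Prime := ⟨CharP.char_is_prime F p⟩
  obtain ⟨j, hj, hcard⟩ := FiniteField.card F p
  have hpK : CharP K p := charP_of_injective_algebraMap (algebraMap F K).injective p
  set q := Fintype.card F with hq
  set r := q ^ m with hr
  have hq2 : 2 ≤ q := Fintype.one_lt_card
  have hKc : Fintype.card K = r ^ 2 := by
    rw [Module.card_eq_pow_finrank (K := F), hfin, hr, ← hq]; ring
  let N : F → Finset K := fun c =>
    univ.filter (fun x : K => x ≠ 0 ∧ Algebra.trace F K (x + algebraMap F K a / x) = c)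
  have hN : ∀ c, q * #(N c) ≤ r ^ 2 + (2 * q ^ 2 + 3) * r := by
    intro c
    obtain ⟨e, he⟩ := Algebra.trace_surjective F K c
    refine kl_stepanov K p (j * m) j q r (by rw [hr, hcard, pow_mul]) hcard hKc hq2
      (Nat.pow_le_pow_right (by omega) hm) (algebraMap F K a) e (univ.image (algebraMap F K)) ?_ ?_
      (N c) ?_
    · rw [Finset.card_image_of_injective _ (algebraMap F K).injective, Finset.card_univ]
    · intro c hc
      obtain ⟨c, _, rfl⟩ := Finset.mem_image.1 hc
      rw [← map_pow, hq, FiniteField.pow_card]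
    · intro x hx
      simp only [N, mem_filter, mem_univ, true_and] at hx
      refine ⟨hx.1, kl_hilbert90 F K _ ?_⟩
      rw [map_sub, hx.2, he, sub_self]
  have hsumN : ∑ c, #(N c) + 1 = r ^ 2 := by
    have h1 : #(univ.filter (fun x : K => x ≠ 0)) = ∑ c, #(N c) := by
      rw [Finset.card_eq_sum_card_fiberwise
        (f := fun x : K => Algebra.trace F K (x + algebraMap F K a / x)) (t := univ)
        (fun _ _ => by simp)]
      refine Finset.sum_congr rfl fun c _ => ?_
      rw [Finset.filter_filter]
    rw [← h1, ← hKc, Finset.filter_ne', Finset.card_erase_of_mem (mem_univ _), Finset.card_univ]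
    have := Fintype.card_pos (α := K)
    omega
  have hsplit : ∑ x ∈ univ.filter (fun x : K => x ≠ 0),
      ψ (Algebra.trace F K (x + algebraMap F K a / x)) = ∑ c, (#(N c) : ℂ) * ψ c := by
    rw [← Finset.sum_fiberwise (univ.filter (fun x : K => x ≠ 0))
      (fun x : K => Algebra.trace F K (x + algebraMap F K a / x))]
    refine Finset.sum_congr rfl fun c _ => ?_
    rw [Finset.filter_filter, Finset.sum_congr rfl (g := fun _ => ψ c)]
    · rw [Finset.sum_const, nsmul_eq_mul]
    · intro x hx
      rw [(Finset.mem_filter.1 hx).2.2]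
  have hψ0 : ∑ c, ψ c = 0 := AddChar.sum_eq_zero_of_ne_one hψ
  have hqR : (0 : ℝ) < q := by exact_mod_cast (by omega : 0 < q)
  have hr1 : (1 : ℝ) ≤ r := by exact_mod_cast Nat.one_le_pow _ _ (by omega)
  let D : ℝ := (2 * q ^ 2 + 3) * r
  have hD : 0 ≤ D := by positivity
  have hNR : ∀ c, (q : ℝ) * #(N c) ≤ r ^ 2 + D := fun c => by simp only [D]; exact_mod_cast hN c
  have hsumR : ∑ c, (#(N c) : ℝ) = r ^ 2 - 1 := by
    have : ((∑ c, #(N c) + 1 : ℕ) : ℝ) = ((r ^ 2 : ℕ) : ℝ) := by rw [hsumN]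
    push_cast at this
    push_cast
    linarith
  have habs : ∑ c, |(q : ℝ) * #(N c) - r ^ 2| ≤ q + 2 * q * D := by
    calc ∑ c, |(q : ℝ) * #(N c) - r ^ 2| ≤ ∑ c, (r ^ 2 + D - q * #(N c) + D) := by
          refine Finset.sum_le_sum fun c _ => ?_
          have := hNR c
          rw [abs_le]; constructor <;> linarith
      _ = _ := by
          rw [Finset.sum_add_distrib, Finset.sum_sub_distrib, ← Finset.mul_sum, hsumR]
          simp only [Finset.sum_const, Finset.card_univ, nsmul_eq_mul, ← hq]
          ring
  have hfinal : (q : ℝ) * ‖∑ c, (#(N c) : ℂ) * ψ c‖ ≤ q + 2 * q * D := by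
    have h1 : (q : ℂ) * ∑ c, (#(N c) : ℂ) * ψ c
        = ∑ c, (((q : ℝ) * #(N c) - r ^ 2 : ℝ) : ℂ) * ψ c := by
      have h2 : ∑ c, ((r : ℂ) ^ 2) * ψ c = 0 := by rw [← Finset.mul_sum, hψ0, mul_zero]
      rw [Finset.mul_sum, ← sub_zero (∑ c, (q : ℂ) * _), ← h2, ← Finset.sum_sub_distrib]
      refine Finset.sum_congr rfl fun c _ => ?_
      push_cast; ring
    calc (q : ℝ) * ‖∑ c, (#(N c) : ℂ) * ψ c‖ = ‖(q : ℂ) * ∑ c, (#(N c) : ℂ) * ψ c‖ := by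
          rw [norm_mul, Complex.norm_natCast]
      _ ≤ ∑ c, ‖(((q : ℝ) * #(N c) - r ^ 2 : ℝ) : ℂ) * ψ c‖ := by rw [h1]; exact norm_sum_le _ _
      _ = ∑ c, |(q : ℝ) * #(N c) - r ^ 2| := by
          refine Finset.sum_congr rfl fun c _ => ?_
          rw [norm_mul, AddChar.norm_apply, mul_one, Complex.norm_real, Real.norm_eq_abs]
      _ ≤ _ := habs
  rw [hsplit]
  have h5 : ‖∑ c, (#(N c) : ℂ) * ψ c‖ ≤ 1 + 2 * D := by
    have : (q : ℝ) * ‖∑ c, (#(N c) : ℂ) * ψ c‖ ≤ q * (1 + 2 * D) := by linarith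
    exact le_of_mul_le_mul_left this hqR
  refine h5.trans ?_
  have h6 : ((q : ℝ) ^ m) = r := by rw [hr]; push_cast; rfl
  rw [h6]
  simp only [D]
  nlinarith

/-- monic polynomials of degree `n` -/
noncomputable def klM (F : Type) [Field F] [Fintype F] (n : ℕ) : Finset (Polynomial F) :=
  letI := Classical.decEq (Polynomial F)
  (Fintype.piFinset (fun _ : Fin n => (univ : Finset F))).image
    (fun c => Polynomial.X ^ n + ∑ i : Fin n, Polynomial.C (c i) * Polynomial.X ^ (i : ℕ))

theorem mem_klM {F : Type} [Field F] [Fintype F] {n : ℕ} {P : Polynomial F} :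
    P ∈ klM F n ↔ P.Monic ∧ P.natDegree = n := by
  classical
  simp only [klM, mem_image, Fintype.mem_piFinset, mem_univ, implies_true, true_and]
  constructor
  · rintro ⟨c, rfl⟩
    have hd := Polynomial.degree_sum_fin_lt c
    refine ⟨Polynomial.monic_X_pow_add hd, ?_⟩
    apply Polynomial.natDegree_eq_of_degree_eq_some
    rw [Polynomial.degree_add_eq_left_of_degree_lt, Polynomial.degree_X_pow]
    rwa [Polynomial.degree_X_pow]
  · rintro ⟨hm, rfl⟩
    refine ⟨fun i => P.coeff i, ?_⟩
    conv_rhs => rw [hm.as_sum]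
    rw [Finset.sum_range]

/-- the multiplicative function attached to the Kloosterman sum -/
noncomputable def klLam {F : Type} [Field F] (ψ : AddChar F ℂ) (a : F) (P : Polynomial F) : ℂ :=
  letI := Classical.dec (P.coeff 0 = 0)
  if P.coeff 0 = 0 then 0 else ψ (-P.nextCoeff - a * P.coeff 1 / P.coeff 0)

theorem klLam_mul {F : Type} [Field F] (ψ : AddChar F ℂ) (a : F) {P Q : Polynomial F}
    (hP : P.Monic) (hQ : Q.Monic) : klLam ψ a (P * Q) = klLam ψ a P * klLam ψ a Q := by
  classical
  unfold klLam
  rw [Polynomial.mul_coeff_zero]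
  by_cases h1 : P.coeff 0 = 0
  · simp [h1]
  by_cases h2 : Q.coeff 0 = 0
  · simp [h2]
  rw [if_neg (mul_ne_zero h1 h2), if_neg h1, if_neg h2, ← AddChar.map_add_eq_mul,
    hP.nextCoeff_mul hQ, Polynomial.mul_coeff_one]
  congr 1
  field_simp
  ring

theorem klLam_one {F : Type} [Field F] (ψ : AddChar F ℂ) (a : F) : klLam ψ a 1 = 1 := by
  simp [klLam, Polynomial.nextCoeff, Polynomial.coeff_one]

theorem klLam_pow {F : Type} [Field F] (ψ : AddChar F ℂ) (a : F) {P : Polynomial F}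
    (hP : P.Monic) (j : ℕ) : klLam ψ a (P ^ j) = klLam ψ a P ^ j := by
  induction j with
  | zero => simp [klLam_one]
  | succ j ih => rw [pow_succ, klLam_mul ψ a (hP.pow j) hP, ih, pow_succ]

noncomputable def klI (F : Type) [Field F] [Fintype F] (n : ℕ) : Finset (Polynomial F) :=
  letI := Classical.decEq (Polynomial F)
  letI := Classical.decPred (fun P : Polynomial F => Irreducible P)
  ((range (n + 1)).biUnion (klM F)).filter (fun P => Irreducible P)

theorem mem_klI {F : Type} [Field F] [Fintype F] {n : ℕ} {P : Polynomial F} :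
    P ∈ klI F n ↔ P.Monic ∧ P.natDegree ≤ n ∧ Irreducible P := by
  simp only [klI, mem_filter, mem_biUnion, mem_range, mem_klM]
  constructor
  · rintro ⟨⟨d, hd, hm, rfl⟩, hi⟩; exact ⟨hm, by omega, hi⟩
  · rintro ⟨hm, hd, hi⟩; exact ⟨⟨_, by omega, hm, rfl⟩, hi⟩

open Classical in
theorem kl_degree_count {F : Type} [Field F] [Fintype F] {n : ℕ} {f : Polynomial F}
    (hf : f ∈ klM F n) :
    n = ∑ P ∈ klI F n, P.natDegree * #((Icc 1 n).filter (fun j => P ^ j ∣ f)) := by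
  obtain ⟨hm, hd⟩ := mem_klM.1 hf
  have hf0 : f ≠ 0 := hm.ne_zero
  let s := UniqueFactorizationMonoid.normalizedFactors f
  have hsmon : ∀ P ∈ s, P.Monic := by
    intro P hP
    have h1 := UniqueFactorizationMonoid.normalize_normalized_factor P hP
    rw [← h1]
    exact Polynomial.monic_normalize (UniqueFactorizationMonoid.irreducible_of_normalized_factor P hP).ne_zero
  have hprod : s.prod = f := by
    have h1 := UniqueFactorizationMonoid.prod_normalizedFactors_eq hf0
    rw [h1, hm.normalize_eq_self]
  have hsub : s.toFinset ⊆ klI F n := by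
    intro P hP
    rw [Multiset.mem_toFinset] at hP
    refine mem_klI.2 ⟨hsmon P hP, ?_, UniqueFactorizationMonoid.irreducible_of_normalized_factor P hP⟩
    rw [← hd]
    exact Polynomial.natDegree_le_of_dvd (UniqueFactorizationMonoid.dvd_of_mem_normalizedFactors hP) hf0
  have hdeg : n = ∑ P ∈ klI F n, s.count P * P.natDegree := by
    calc n = f.natDegree := hd.symm
      _ = s.prod.natDegree := by rw [hprod]
      _ = (s.map Polynomial.natDegree).sum := Polynomial.natDegree_multiset_prod_of_monic _ hsmon
      _ = ∑ P ∈ s.toFinset, s.count P * P.natDegree := by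
          rw [Finset.sum_multiset_map_count]; rfl
      _ = _ := by
          refine Finset.sum_subset hsub fun P _ hP => ?_
          rw [Multiset.count_eq_zero_of_notMem (by simpa using hP), zero_mul]
  conv_lhs => rw [hdeg]
  refine Finset.sum_congr rfl fun P hP => ?_
  obtain ⟨hPm, hPd, hPi⟩ := mem_klI.1 hP
  rw [mul_comm]
  congr 1
  have hiff : ∀ j, P ^ j ∣ f ↔ j ≤ s.count P := by
    intro j
    rw [UniqueFactorizationMonoid.dvd_iff_normalizedFactors_le_normalizedFactors
      (pow_ne_zero _ hPm.ne_zero) hf0, UniqueFactorizationMonoid.normalizedFactors_pow,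
      UniqueFactorizationMonoid.normalizedFactors_irreducible hPi, hPm.normalize_eq_self,
      Multiset.nsmul_singleton, Multiset.le_count_iff_replicate_le]
  have hcn : s.count P ≤ n := by
    have h1 := (hiff _).2 le_rfl
    have h2 := Polynomial.natDegree_le_of_dvd h1 hf0
    rw [Polynomial.natDegree_pow, hd] at h2
    have h3 := hPi.natDegree_pos
    nlinarith
  have : (Icc 1 n).filter (fun j => P ^ j ∣ f) = Icc 1 (s.count P) := by
    ext j
    simp only [mem_filter, mem_Icc, hiff]
    omega
  rw [this, Nat.card_Icc]; omega

noncomputable def klA {F : Type} [Field F] [Fintype F] (ψ : AddChar F ℂ) (a : F) (n : ℕ) : ℂ :=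
  ∑ f ∈ klM F n, klLam ψ a f

noncomputable def klS {F : Type} [Field F] [Fintype F] (ψ : AddChar F ℂ) (a : F) (n k : ℕ) : ℂ :=
  ∑ P ∈ klI F n, if P.natDegree ∣ k then (P.natDegree : ℂ) * klLam ψ a P ^ (k / P.natDegree) else 0

open Classical in
theorem kl_inner {F : Type} [Field F] [Fintype F] (ψ : AddChar F ℂ) (a : F) (n j : ℕ)
    (P : Polynomial F) (hP : P.Monic) :
    ∑ f ∈ (klM F n).filter (fun f => P ^ j ∣ f), klLam ψ a f
      = if j * P.natDegree ≤ n then klLam ψ a P ^ j * klA ψ a (n - j * P.natDegree) else 0 := by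
  have hPj : (P ^ j).Monic := hP.pow j
  have hPd : (P ^ j).natDegree = j * P.natDegree := Polynomial.natDegree_pow _ _
  split_ifs with h
  · have : (klM F n).filter (fun f => P ^ j ∣ f)
        = (klM F (n - j * P.natDegree)).image (fun g => P ^ j * g) := by
      ext f
      simp only [mem_filter, mem_image, mem_klM]
      constructor
      · rintro ⟨⟨hm, hd⟩, g, rfl⟩
        have hg : g.Monic := hPj.of_mul_monic_left hm
        refine ⟨g, ⟨hg, ?_⟩, rfl⟩
        rw [hPj.natDegree_mul hg, hPd] at hd
        omega
      · rintro ⟨g, ⟨hg, hd⟩, rfl⟩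
        refine ⟨⟨hPj.mul hg, ?_⟩, dvd_mul_right _ _⟩
        rw [hPj.natDegree_mul hg, hPd]; omega
    rw [this, Finset.sum_image (fun g _ g' _ h => mul_left_cancel₀ hPj.ne_zero h), klA, Finset.mul_sum]
    refine Finset.sum_congr rfl fun g hg => ?_
    rw [klLam_mul ψ a hPj (mem_klM.1 hg).1, klLam_pow ψ a hP]
  · refine Finset.sum_eq_zero fun f hf => ?_
    exfalso
    rw [mem_filter, mem_klM] at hf
    have := Polynomial.natDegree_le_of_dvd hf.2 hf.1.1.ne_zero
    rw [hPd] at this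
    omega

open Classical in
theorem kl_newton {F : Type} [Field F] [Fintype F] (ψ : AddChar F ℂ) (a : F) (n : ℕ) :
    (n : ℂ) * klA ψ a n = ∑ k ∈ Icc 1 n, klS ψ a n k * klA ψ a (n - k) := by
  have h1 : (n : ℂ) * klA ψ a n = ∑ P ∈ klI F n, ∑ j ∈ Icc 1 n, (P.natDegree : ℂ) *
      ∑ f ∈ (klM F n).filter (fun f => P ^ j ∣ f), klLam ψ a f := by
    calc (n : ℂ) * klA ψ a n = ∑ f ∈ klM F n, (n : ℂ) * klLam ψ a f := by rw [klA, Finset.mul_sum]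
      _ = ∑ f ∈ klM F n, ∑ P ∈ klI F n, ∑ j ∈ Icc 1 n,
            if P ^ j ∣ f then (P.natDegree : ℂ) * klLam ψ a f else 0 := by
          refine Finset.sum_congr rfl fun f hf => ?_
          have h := congrArg (Nat.cast : ℕ → ℂ) (kl_degree_count hf)
          rw [h, Nat.cast_sum, Finset.sum_mul]
          refine Finset.sum_congr rfl fun P _ => ?_
          rw [← Finset.sum_filter, Finset.sum_const, nsmul_eq_mul]
          push_cast; ring
      _ = ∑ P ∈ klI F n, ∑ j ∈ Icc 1 n, ∑ f ∈ klM F n,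
            if P ^ j ∣ f then (P.natDegree : ℂ) * klLam ψ a f else 0 := by
          rw [Finset.sum_comm]
          refine Finset.sum_congr rfl fun P _ => ?_
          rw [Finset.sum_comm]
      _ = _ := by
          refine Finset.sum_congr rfl fun P _ => Finset.sum_congr rfl fun j _ => ?_
          rw [← Finset.sum_filter, Finset.mul_sum]
  rw [h1]
  have h2 : ∀ k ∈ Icc 1 n, klS ψ a n k * klA ψ a (n - k) = ∑ P ∈ klI F n,
      (if P.natDegree ∣ k then (P.natDegree : ℂ) * klLam ψ a P ^ (k / P.natDegree) else 0)
        * klA ψ a (n - k) := fun k _ => by rw [klS, Finset.sum_mul]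
  rw [Finset.sum_congr rfl h2]
  refine Eq.trans ?_ Finset.sum_comm
  refine Finset.sum_congr rfl fun P hP => ?_
  obtain ⟨hPm, hPd, hPi⟩ := mem_klI.1 hP
  have hpos := hPi.natDegree_pos
  simp only [kl_inner ψ a n _ P hPm, mul_ite, mul_zero, ite_mul, zero_mul]
  rw [← Finset.sum_filter, ← Finset.sum_filter]
  refine Finset.sum_bij' (fun j _ => j * P.natDegree) (fun k _ => k / P.natDegree) ?_ ?_ ?_ ?_ ?_
  · intro j hj
    simp only [mem_filter, mem_Icc] at hj ⊢
    exact ⟨⟨Nat.mul_pos hj.1.1 hpos, hj.2⟩, Nat.dvd_mul_left _ _⟩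
  · intro k hk
    simp only [mem_filter, mem_Icc] at hk ⊢
    obtain ⟨⟨hk1, hk2⟩, d, rfl⟩ := hk
    rw [Nat.mul_div_cancel_left _ hpos]
    have : 0 < d := Nat.pos_of_mul_pos_left hk1
    refine ⟨⟨this, ?_⟩, by rw [mul_comm]; exact hk2⟩
    nlinarith
  · intro j _
    exact Nat.mul_div_cancel _ hpos
  · intro k hk
    exact Nat.div_mul_cancel (mem_filter.1 hk).2
  · intro j _
    rw [Nat.mul_div_cancel _ hpos, mul_assoc]

section
open IntermediateField

theorem kl_minpoly_inv {F K : Type} [Field F] [Field K] [Algebra F K] [FiniteDimensional F K]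
    (x : K) (hx : x ≠ 0) :
    (minpoly F x⁻¹).nextCoeff = (minpoly F x).coeff 1 / (minpoly F x).coeff 0 := by
  have hint : IsIntegral F x := .of_finite F x
  have hint' : IsIntegral F x⁻¹ := .of_finite F x⁻¹
  set P := minpoly F x with hP
  have hc0 : P.coeff 0 ≠ 0 := minpoly.coeff_zero_ne_zero hint hx
  have hmon : P.Monic := minpoly.monic hint
  have htr : P.natTrailingDegree = 0 := by
    rw [Polynomial.natTrailingDegree_eq_zero]; exact Or.inr hc0
  have hrd : P.reverse.natDegree = P.natDegree := by
    rw [Polynomial.reverse_natDegree, htr, Nat.sub_zero]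
  have hpos : 0 < P.natDegree := minpoly.natDegree_pos hint
  have hadj : F⟮x⁻¹⟯ = F⟮x⟯ := by
    apply le_antisymm
    · rw [adjoin_simple_le_iff]; exact inv_mem (mem_adjoin_simple_self F x)
    · rw [adjoin_simple_le_iff]
      have := inv_mem (mem_adjoin_simple_self F x⁻¹)
      rwa [inv_inv] at this
  have hdeg : (minpoly F x⁻¹).natDegree = P.natDegree := by
    rw [hP, ← IntermediateField.adjoin.finrank hint, ← IntermediateField.adjoin.finrank hint', hadj]
  let Q : Polynomial F := Polynomial.C (P.coeff 0)⁻¹ * P.reverse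
  have hQd : Q.natDegree = P.natDegree := by
    rw [Polynomial.natDegree_C_mul (inv_ne_zero hc0), hrd]
  have hlead : P.reverse.leadingCoeff = P.coeff 0 := by
    rw [Polynomial.reverse_leadingCoeff, Polynomial.trailingCoeff, htr]
  have hQm : Q.Monic := by
    rw [Polynomial.Monic, Polynomial.leadingCoeff_mul, Polynomial.leadingCoeff_C, hlead,
      inv_mul_cancel₀ hc0]
  have hQ0 : Polynomial.aeval x⁻¹ Q = 0 := by
    rw [map_mul, Polynomial.aeval_def, Polynomial.aeval_def]
    let _ : Invertible x := invertibleOfNonzero hx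
    have h := (Polynomial.eval₂_reverse_eq_zero_iff (algebraMap F K) x P).2 (minpoly.aeval F x)
    rw [invOf_eq_inv] at h
    rw [h, mul_zero]
  have hQeq : Q = minpoly F x⁻¹ := by
    have hdvd := minpoly.dvd F x⁻¹ hQ0
    exact (Polynomial.eq_of_monic_of_dvd_of_natDegree_le (minpoly.monic hint') hQm hdvd
      (by rw [hQd, hdeg])).symm ▸ rfl
  rw [← hQeq, Polynomial.nextCoeff_of_natDegree_pos (by rw [hQd]; exact hpos), hQd,
    Polynomial.coeff_C_mul, Polynomial.coeff_reverse, Polynomial.revAt_le (by omega)]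
  rw [show P.natDegree - (P.natDegree - 1) = 1 by omega]
  field_simp

theorem kl_char_eq {F K : Type} [Field F] [Fintype F] [Field K] [Fintype K] [Algebra F K]
    (ψ : AddChar F ℂ) (a : F) (x : K) (hx : x ≠ 0) :
    ψ (Algebra.trace F K (x + algebraMap F K a / x)) =
      klLam ψ a (minpoly F x) ^ (Module.finrank F K / (minpoly F x).natDegree) := by
  classical
  have hint : IsIntegral F x := .of_finite F x
  have hc0 : (minpoly F x).coeff 0 ≠ 0 := minpoly.coeff_zero_ne_zero hint hx
  have hadj : F⟮x⁻¹⟯ = F⟮x⟯ := by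
    apply le_antisymm
    · rw [adjoin_simple_le_iff]; exact inv_mem (mem_adjoin_simple_self F x)
    · rw [adjoin_simple_le_iff]
      have := inv_mem (mem_adjoin_simple_self F x⁻¹)
      rwa [inv_inv] at this
  have hfr : Module.finrank F K / (minpoly F x).natDegree = Module.finrank F⟮x⟯ K := by
    rw [← IntermediateField.adjoin.finrank hint, ← Module.finrank_mul_finrank F F⟮x⟯ K,
      Nat.mul_div_cancel_left _ Module.finrank_pos]
  have htr : Algebra.trace F K (x + algebraMap F K a / x) = Module.finrank F⟮x⟯ K •
      (-(minpoly F x).nextCoeff - a * (minpoly F x).coeff 1 / (minpoly F x).coeff 0) := by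
    rw [map_add, div_eq_mul_inv, ← Algebra.smul_def, map_smul,
      trace_eq_finrank_mul_minpoly_nextCoeff, trace_eq_finrank_mul_minpoly_nextCoeff F x⁻¹, hadj,
      kl_minpoly_inv x hx, nsmul_eq_mul, smul_eq_mul]
    ring
  rw [htr, AddChar.map_nsmul_eq_pow, hfr, klLam, if_neg hc0]

theorem kl_fiber {F K : Type} [Field F] [Fintype F] [Field K] [Fintype K] [DecidableEq K]
    [DecidableEq (Polynomial F)] [Algebra F K]
    (P : Polynomial F) (hm : P.Monic) (hi : Irreducible P) :
    #(univ.filter (fun x : K => minpoly F x = P)) =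
      if P.natDegree ∣ Module.finrank F K then P.natDegree else 0 := by
  split_ifs with h
  · have hsp : (P.map (algebraMap F K)).Splits := by
      have h1 := (Irreducible.natDegree_dvd_iff_dvd_X_pow_card_pow_sub_X hi).1 h
      rw [Nat.card_eq_fintype_card, ← Module.card_eq_pow_finrank (K := F) (V := K)] at h1
      have h2 := Polynomial.map_dvd (algebraMap F K) h1
      refine Polynomial.Splits.of_dvd ?_ ?_ h2
      · simp only [Polynomial.map_sub, Polynomial.map_pow, Polynomial.map_X]
        rw [Polynomial.splits_iff_card_roots, FiniteField.roots_X_pow_card_sub_X, ← Finset.card_def,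
          Finset.card_univ, FiniteField.X_pow_card_sub_X_natDegree_eq K Fintype.one_lt_card]
      · simp only [Polynomial.map_sub, Polynomial.map_pow, Polynomial.map_X]
        exact FiniteField.X_pow_card_sub_X_ne_zero K Fintype.one_lt_card
    have hsep : P.Separable := PerfectField.separable_of_irreducible hi
    rw [← Polynomial.card_rootSet_eq_natDegree hsep hsp, ← Set.toFinset_card]
    congr 1
    ext x
    rw [mem_filter, Set.mem_toFinset, Polynomial.mem_rootSet]
    constructor
    · rintro ⟨_, rfl⟩; exact ⟨hm.ne_zero, minpoly.aeval F x⟩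
    · rintro ⟨_, hx⟩; exact ⟨mem_univ _, (minpoly.eq_of_irreducible_of_monic hi hx hm).symm⟩
  · rw [Finset.card_eq_zero, Finset.filter_eq_empty_iff]
    rintro x _ rfl
    exact h (minpoly.degree_dvd (.of_finite F x))

theorem klS_eq {F K : Type} [Field F] [Fintype F] [Field K] [Fintype K] [DecidableEq K]
    [Algebra F K] (ψ : AddChar F ℂ) (a : F) (n k : ℕ) (hk : Module.finrank F K = k) (hn : k ≤ n) :
    klS ψ a n k =
      ∑ x ∈ univ.filter (fun x : K => x ≠ 0), ψ (Algebra.trace F K (x + algebraMap F K a / x)) := by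
  classical
  have hkpos : 0 < k := by rw [← hk]; exact Module.finrank_pos
  have h1 : ∑ x ∈ univ.filter (fun x : K => x ≠ 0), ψ (Algebra.trace F K (x + algebraMap F K a / x))
      = ∑ x : K, klLam ψ a (minpoly F x) ^ (k / (minpoly F x).natDegree) := by
    rw [Finset.sum_filter]
    refine Finset.sum_congr rfl fun x _ => ?_
    split_ifs with hx
    · rw [kl_char_eq ψ a x hx, hk]
    · have hx0 : x = 0 := by simpa using hx
      rw [hx0, minpoly.zero, klLam, if_pos (by simp), Polynomial.natDegree_X, Nat.div_one,
        zero_pow hkpos.ne']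
  rw [h1, ← Finset.sum_fiberwise_of_maps_to (s := univ) (t := klI F n) (g := fun x : K => minpoly F x)]
  · rw [klS]
    refine Finset.sum_congr rfl fun P hP => ?_
    obtain ⟨hPm, hPd, hPi⟩ := mem_klI.1 hP
    rw [Finset.sum_congr rfl (g := fun _ => klLam ψ a P ^ (k / P.natDegree))]
    · rw [Finset.sum_const, kl_fiber P hPm hPi, hk]
      split_ifs <;> simp
    · intro x hx
      rw [(mem_filter.1 hx).2]
  · intro x _
    refine mem_klI.2 ⟨minpoly.monic (.of_finite F x), ?_, minpoly.irreducible (.of_finite F x)⟩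
    refine le_trans (Nat.le_of_dvd hkpos ?_) hn
    rw [← hk]
    exact minpoly.degree_dvd (.of_finite F x)
end

open Polynomial in
theorem klA_zero {F : Type} [Field F] [Fintype F] (ψ : AddChar F ℂ) (a : F) : klA ψ a 0 = 1 := by
  have : klM F 0 = {1} := by
    ext P
    rw [mem_klM, mem_singleton]
    constructor
    · rintro ⟨h1, h2⟩
      exact h1.natDegree_eq_zero.1 h2
    · rintro rfl; exact ⟨monic_one, natDegree_one⟩
  rw [klA, this, sum_singleton, klLam_one]

open Polynomial in
theorem klA_big {F : Type} [Field F] [Fintype F] (ψ : AddChar F ℂ) (hψ : ψ ≠ 1) (a : F) (n : ℕ)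
    (hn : 3 ≤ n) : klA ψ a n = 0 := by
  classical
  obtain ⟨b, hb⟩ := (AddChar.ne_one_iff).1 hψ
  have hmem : ∀ (c : F) (f : F[X]), f ∈ klM F n → f + C c * X ^ (n - 1) ∈ klM F n := by
    intro c f hf
    obtain ⟨h1, h2⟩ := mem_klM.1 hf
    have hlt : (C c * X ^ (n - 1)).degree < f.degree := by
      refine lt_of_le_of_lt (degree_C_mul_X_pow_le _ _) ?_
      rw [degree_eq_natDegree h1.ne_zero, h2]
      exact_mod_cast (by omega)
    refine mem_klM.2 ⟨h1.add_of_left hlt, ?_⟩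
    rw [natDegree_add_eq_left_of_degree_lt hlt, h2]
  have hval : ∀ f ∈ klM F n, klLam ψ a f = ψ b * klLam ψ a (f + C b * X ^ (n - 1)) := by
    intro f hf
    obtain ⟨h1, h2⟩ := mem_klM.1 hf
    obtain ⟨h3, h4⟩ := mem_klM.1 (hmem b f hf)
    have hc0 : (f + C b * X ^ (n - 1)).coeff 0 = f.coeff 0 := by
      rw [coeff_add, coeff_C_mul_X_pow, if_neg (by omega), add_zero]
    have hc1 : (f + C b * X ^ (n - 1)).coeff 1 = f.coeff 1 := by
      rw [coeff_add, coeff_C_mul_X_pow, if_neg (by omega), add_zero]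
    have hnc : (f + C b * X ^ (n - 1)).nextCoeff = f.nextCoeff + b := by
      rw [nextCoeff_of_natDegree_pos (by omega), nextCoeff_of_natDegree_pos (by omega), h4, h2,
        coeff_add, coeff_C_mul_X_pow, if_pos rfl]
    unfold klLam
    rw [hc0, hc1, hnc]
    split_ifs with h
    · simp
    · rw [← AddChar.map_add_eq_mul]; congr 1; ring
  have hsum : ∑ f ∈ klM F n, klLam ψ a (f + C b * X ^ (n - 1)) = ∑ f ∈ klM F n, klLam ψ a f := by
    refine Finset.sum_nbij' (fun f => f + C b * X ^ (n - 1)) (fun f => f + C (-b) * X ^ (n - 1))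
      (fun f hf => hmem b f hf) (fun f hf => hmem (-b) f hf) ?_ ?_ (fun _ _ => rfl)
    · intro f _; rw [C_neg]; ring
    · intro f _; rw [C_neg]; ring
  have : klA ψ a n = ψ b * klA ψ a n := by
    conv_lhs => rw [klA, sum_congr rfl hval, ← mul_sum, hsum]
    rfl
  have h2 : (1 - ψ b) * klA ψ a n = 0 := by linear_combination this
  rcases mul_eq_zero.1 h2 with h | h
  · exact absurd (sub_eq_zero.1 h).symm hb
  · exact h

open Polynomial in
theorem klA_two {F : Type} [Field F] [Fintype F] (ψ : AddChar F ℂ) (hψ : ψ ≠ 1) (a : F)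
    (ha : a ≠ 0) : klA ψ a 2 = Fintype.card F := by
  classical
  have h1 : klA ψ a 2 = ∑ p : F × F, if p.1 = 0 then 0 else ψ (p.2 * (-(1 + a / p.1))) := by
    symm
    have hd : ∀ p : F × F, (C p.2 * X + C p.1 : F[X]).degree < (2:ℕ) := fun p =>
      lt_of_le_of_lt degree_linear_le (by norm_num)
    refine Finset.sum_nbij' (fun p => X ^ 2 + (C p.2 * X + C p.1)) (fun f => (f.coeff 0, f.coeff 1))
      ?_ ?_ ?_ ?_ ?_
    · intro p _
      refine mem_klM.2 ⟨monic_X_pow_add (hd p), ?_⟩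
      apply natDegree_eq_of_degree_eq_some
      rw [degree_add_eq_left_of_degree_lt, degree_X_pow]
      rw [degree_X_pow]; exact hd p
    · intros; exact mem_univ _
    · intro p _
      simp [coeff_X, coeff_C]
    · intro f hf
      obtain ⟨hm, h2⟩ := mem_klM.1 hf
      have := hm.as_sum
      rw [h2, sum_range_succ, sum_range_one] at this
      conv_rhs => rw [this]
      simp; ring
    · intro p _
      have hn : (X ^ 2 + (C p.2 * X + C p.1) : F[X]).natDegree = 2 := by
        apply natDegree_eq_of_degree_eq_some
        rw [degree_add_eq_left_of_degree_lt, degree_X_pow]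
        rw [degree_X_pow]; exact hd p
      rw [klLam, nextCoeff_of_natDegree_pos (by omega), hn]
      simp [coeff_X, coeff_C]
      split_ifs with h
      · rfl
      · congr 1; ring
  rw [h1, ← univ_product_univ, sum_product]
  rw [Finset.sum_eq_single (-a)]
  · simp [ha]
  · intro c _ hc
    by_cases h0 : c = 0
    · simp [h0]
    · simp only [h0, if_false]
      have hne : -(1 + a / c) ≠ 0 := by
        intro h
        apply hc
        field_simp at h
        linear_combination -h
      have := AddChar.sum_eq_zero_of_ne_one hψ
      rw [← this]
      exact Fintype.sum_equiv (Equiv.mulRight₀ _ hne) _ _ (fun x => rfl)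
  · simp

theorem kl_root_le (q C : ℝ) (hq : 0 < q) (α β : ℂ) (hab : α * β = q)
    (h : ∀ m : ℕ, 7 ≤ m → ‖α ^ (2 * m) + β ^ (2 * m)‖ ≤ C * q ^ m) : ‖α‖ ≤ Real.sqrt q := by
  by_contra hcon
  push Not at hcon
  have hA : q < ‖α‖ ^ 2 := (Real.sqrt_lt' (lt_of_le_of_lt (Real.sqrt_nonneg q) hcon)).1 hcon
  have hAB : ‖α‖ ^ 2 * ‖β‖ ^ 2 = q ^ 2 := by
    rw [← mul_pow, ← norm_mul, hab, Complex.norm_real, Real.norm_of_nonneg hq.le]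
  have hB : ‖β‖ ^ 2 ≤ q := by
    by_contra hb
    push Not at hb
    nlinarith [mul_lt_mul hA hb.le hq (by positivity)]
  have key : ∀ m : ℕ, 7 ≤ m → (‖α‖ ^ 2 / q) ^ m ≤ C + 1 := by
    intro m hm
    rw [div_pow, div_le_iff₀ (by positivity)]
    have h1 := h m hm
    have h2 : ‖α ^ (2 * m)‖ ≤ ‖α ^ (2 * m) + β ^ (2 * m)‖ + ‖β ^ (2 * m)‖ := by
      have := norm_sub_le (α ^ (2 * m) + β ^ (2 * m)) (β ^ (2 * m))
      rwa [add_sub_cancel_right] at this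
    rw [norm_pow α, norm_pow β, pow_mul ‖α‖, pow_mul ‖β‖] at h2
    have h3 : (‖β‖ ^ 2) ^ m ≤ q ^ m := pow_le_pow_left₀ (by positivity) hB m
    linarith
  have hr : 1 < ‖α‖ ^ 2 / q := by rwa [one_lt_div hq]
  obtain ⟨m, hm⟩ := pow_unbounded_of_one_lt (C + 1) hr
  have h1 := key (m + 7) (by omega)
  have h2 : (‖α‖ ^ 2 / q) ^ m ≤ (‖α‖ ^ 2 / q) ^ (m + 7) := pow_le_pow_right₀ hr.le (by omega)
  linarith

theorem kl_rec_bound (q C : ℝ) (hq : 0 < q) (k : ℂ) (s : ℕ → ℂ) (h1 : s 1 = k)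
    (h2 : s 2 = 2 * q - k ^ 2) (h3 : ∀ n, s (n + 3) + k * s (n + 2) + q * s (n + 1) = 0)
    (h : ∀ m : ℕ, 7 ≤ m → ‖s (2 * m)‖ ≤ C * q ^ m) : ‖k‖ ≤ 2 * Real.sqrt q := by
  obtain ⟨d, hd⟩ := IsAlgClosed.exists_pow_nat_eq (k ^ 2 - 4 * q) (n := 2) (by norm_num)
  obtain ⟨α, β, hs, hp⟩ : ∃ α β : ℂ, α + β = -k ∧ α * β = q :=
    ⟨(-k + d) / 2, (-k - d) / 2, by ring, by linear_combination -hd / 4⟩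
  have hform : ∀ n, s (n + 1) = -(α ^ (n + 1) + β ^ (n + 1)) ∧
      s (n + 2) = -(α ^ (n + 2) + β ^ (n + 2)) := by
    intro n
    induction n with
    | zero =>
      refine ⟨by rw [h1]; linear_combination hs, ?_⟩
      rw [h2, ← hp]
      linear_combination (α + β - k) * hs
    | succ n ih =>
      refine ⟨ih.2, ?_⟩
      have := h3 n
      rw [ih.1, ih.2, ← hp] at this
      have hk : k = -(α + β) := by rw [hs]; ring
      rw [hk] at this
      rw [show n + 1 + 2 = n + 3 by ring]
      linear_combination this
  have hb : ∀ m : ℕ, 7 ≤ m → ‖α ^ (2 * m) + β ^ (2 * m)‖ ≤ C * q ^ m := by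
    intro m hm
    have := h m hm
    obtain ⟨j, hj⟩ : ∃ j, 2 * m = j + 1 := ⟨2 * m - 1, by omega⟩
    rwa [hj, (hform j).1, ← hj, norm_neg] at this
  have hα := kl_root_le q C hq α β hp hb
  have hβ := kl_root_le q C hq β α (by rw [mul_comm, hp]) (by
    intro m hm; rw [add_comm]; exact hb m hm)
  calc ‖k‖ = ‖α + β‖ := by rw [hs, norm_neg]
    _ ≤ ‖α‖ + ‖β‖ := norm_add_le _ _
    _ ≤ _ := by linarith

theorem kl_weil {F : Type} [Field F] [Fintype F] [DecidableEq F] (ψ : AddChar F ℂ) (hψ : ψ ≠ 1)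
    (a : F) (ha : a ≠ 0) :
    ‖∑ x ∈ univ.filter (fun x : F => x ≠ 0), ψ (x + a / x)‖ ≤ 2 * Real.sqrt (Fintype.card F) := by
  classical
  obtain ⟨p, hp⟩ := CharP.exists F
  have hpp : Fact p.Prime := ⟨CharP.char_is_prime F p⟩
  have hind : ∀ n k : ℕ, 1 ≤ k → k ≤ n → klS ψ a n k = klS ψ a k k := by
    intro n k hk hn
    have : NeZero k := ⟨by omega⟩
    have : Fintype (FiniteField.Extension F p k) := Fintype.ofFinite _
    rw [klS_eq (K := FiniteField.Extension F p k) ψ a n k (FiniteField.finrank_extension F p k) hn,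
      klS_eq (K := FiniteField.Extension F p k) ψ a k k (FiniteField.finrank_extension F p k) le_rfl]
  have hq : (0 : ℝ) < Fintype.card F := by exact_mod_cast Fintype.card_pos
  have hA0 := klA_zero ψ a
  have hA2 := klA_two ψ hψ a ha
  have hA1 : klA ψ a 1 = klS ψ a 1 1 := by
    have := kl_newton ψ a 1
    simpa [hA0] using this
  have hS1 : klS ψ a 1 1 = ∑ x ∈ univ.filter (fun x : F => x ≠ 0), ψ (x + a / x) := by
    rw [klS_eq (K := F) ψ a 1 1 (Module.finrank_self F) le_rfl]
    simp
  rw [← hS1]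
  refine kl_rec_bound (Fintype.card F) (4 * (Fintype.card F : ℝ) ^ 2 + 7) hq _ (fun k => klS ψ a k k)
    rfl ?_ ?_ ?_
  · have := kl_newton ψ a 2
    rw [show Icc 1 2 = {1, 2} by rfl, sum_pair (by norm_num), hind 2 1 le_rfl (by norm_num)] at this
    simp only [hA2, hA0, hA1, Nat.sub_self, show 2 - 1 = 1 from rfl] at this
    push_cast at this ⊢
    linear_combination -this
  · intro n
    have := kl_newton ψ a (n + 3)
    rw [klA_big ψ hψ a (n + 3) (by omega), sum_Icc_succ_top (by omega),
      sum_Icc_succ_top (by omega), sum_Icc_succ_top (by omega),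
      Finset.sum_eq_zero, hind (n + 3) (n + 1) (by omega) (by omega),
      hind (n + 3) (n + 2) (by omega) (by omega)] at this
    · simp only [show n + 3 - (n + 1) = 2 by omega, show n + 3 - (n + 1 + 1) = 1 by omega,
        show n + 3 - (n + 2 + 1) = 0 by omega, hA0, hA1, hA2] at this
      push_cast at this ⊢
      linear_combination -this
    · intro k hk
      rw [mem_Icc] at hk
      rw [klA_big ψ hψ a _ (by omega), mul_zero]
  · intro m hm
    have : NeZero (2 * m) := ⟨by omega⟩
    have : Fintype (FiniteField.Extension F p (2 * m)) := Fintype.ofFinite _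
    have hb := kl_ext_bound F (FiniteField.Extension F p (2 * m)) m hm
      (FiniteField.finrank_extension F p (2 * m)) ψ hψ a
    rw [← klS_eq (K := FiniteField.Extension F p (2 * m)) ψ a (2 * m) (2 * m)
      (FiniteField.finrank_extension F p (2 * m)) le_rfl] at hb
    exact hb

theorem kl_gauss_one {F : Type} [Field F] [Fintype F] [DecidableEq F] (hF : ringChar F ≠ 2)
    (ψ : AddChar F ℂ) (hψ : ψ ≠ 1) (b : F) (hb : b ≠ 0) :
    (∑ x : F, ψ (b * x ^ 2)) ^ 2 = ((quadraticChar F (-1) : ℤ) : ℂ) * Fintype.card F := by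
  have hprim := AddChar.IsPrimitive.of_ne_one hψ
  let χ : MulChar F ℂ := (quadraticChar F).ringHomComp (Int.castRingHom ℂ)
  have hχ1 : χ ≠ 1 := by
    rw [Ne, MulChar.ringHomComp_eq_one_iff (RingHom.injective_int _)]
    exact quadraticChar_ne_one hF
  have hχ2 : χ.IsQuadratic := (quadraticChar_isQuadratic F).comp _
  have hχv : ∀ x, χ x = ((quadraticChar F x : ℤ) : ℂ) := fun x => rfl
  have h1 : ∑ x : F, ψ (b * x ^ 2) = gaussSum χ (AddChar.mulShift ψ b) := by
    have e1 : ∑ x : F, ψ (b * x ^ 2) = ∑ y : F, ∑ x ∈ univ.filter (fun x : F => x ^ 2 = y), ψ (b * x ^ 2) :=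
      (Finset.sum_fiberwise univ (fun x : F => x ^ 2) _).symm
    have e2 : ∀ y : F, ∑ x ∈ univ.filter (fun x : F => x ^ 2 = y), ψ (b * x ^ 2) =
        χ y * ψ (b * y) + ψ (y * b) := by
      intro y
      rw [sum_congr rfl (g := fun _ => ψ (b * y)) (by
        intro x hx; rw [(mem_filter.1 hx).2]), sum_const, nsmul_eq_mul]
      have := quadraticChar_card_sqrts hF y
      have hc : ((#(univ.filter (fun x : F => x ^ 2 = y)) : ℤ)) = quadraticChar F y + 1 := by
        rw [← this]
        congr 2
        ext x; simp
      have hc' : ((#(univ.filter (fun x : F => x ^ 2 = y)) : ℂ)) = χ y + 1 := by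
        rw [hχv]; exact_mod_cast hc
      rw [hc', mul_comm y b]; ring
    rw [e1, sum_congr rfl (fun y _ => e2 y), sum_add_distrib, AddChar.sum_mulShift b hprim, if_neg hb]
    simp [gaussSum, AddChar.mulShift_apply]
  have h2 := gaussSum_mulShift χ ψ (Units.mk0 b hb)
  have h3 := gaussSum_sq hχ1 hχ2 hprim
  have hb2 : χ b ^ 2 = 1 := by
    rw [hχv]; exact_mod_cast quadraticChar_sq_one hb
  rw [Units.val_mk0] at h2
  rw [h1, ← hχv, ← h3, ← h2, mul_pow, hb2, one_mul]

theorem kl_gauss_lin {F : Type} [Field F] [Fintype F] [DecidableEq F] (h2 : (2 : F) ≠ 0)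
    (ψ : AddChar F ℂ) (s : F) (hs : s ≠ 0) (y : F) :
    ∑ x : F, ψ (-x ^ 2 / (4 * s) + x * y) = ψ (s * y ^ 2) * ∑ x : F, ψ (-(4 * s)⁻¹ * x ^ 2) := by
  have h4 : (4 : F) ≠ 0 := by
    rw [show (4 : F) = 2 * 2 by norm_num]; exact mul_ne_zero h2 h2
  rw [mul_sum]
  refine Fintype.sum_equiv (Equiv.addRight (-(2 * s * y))) _ _ fun x => ?_
  rw [← AddChar.map_add_eq_mul, Equiv.coe_addRight]
  congr 1
  field_simp
  ring

/-- pairing on the plane -/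
def klDot {F : Type} [Field F] (m z : F × F) : F := m.1 * z.1 + m.2 * z.2

theorem kl_gauss_plane {F : Type} [Field F] [Fintype F] [DecidableEq F] (hF : ringChar F ≠ 2)
    (ψ : AddChar F ℂ) (hψ : ψ ≠ 1) (s : F) (hs : s ≠ 0) (z : F × F) :
    ∑ m : F × F, ψ (-nrm m / (4 * s) + klDot m z) =
      ((quadraticChar F (-1) : ℤ) : ℂ) * Fintype.card F * ψ (s * nrm z) := by
  have h2 : (2 : F) ≠ 0 := Ring.two_ne_zero hF
  have h4 : (4 : F) ≠ 0 := by
    rw [show (4 : F) = 2 * 2 by norm_num]; exact mul_ne_zero h2 h2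
  rw [← kl_gauss_one hF ψ hψ (-(4 * s)⁻¹) (neg_ne_zero.2 (inv_ne_zero (mul_ne_zero h4 hs)))]
  have : ∀ m : F × F, ψ (-nrm m / (4 * s) + klDot m z) =
      ψ (-m.1 ^ 2 / (4 * s) + m.1 * z.1) * ψ (-m.2 ^ 2 / (4 * s) + m.2 * z.2) := by
    intro m
    rw [← AddChar.map_add_eq_mul, nrm, klDot]
    congr 1; ring
  rw [sum_congr rfl (fun m _ => this m), ← univ_product_univ, sum_product]
  dsimp only
  rw [← Fintype.sum_mul_sum, kl_gauss_lin h2 ψ s hs, kl_gauss_lin h2 ψ s hs, nrm, mul_add,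
    AddChar.map_add_eq_mul]
  ring

noncomputable def klW {F : Type} [Field F] [Fintype F] [DecidableEq F] (ψ : AddChar F ℂ) (t : F)
    (m : F × F) : ℂ := ∑ s ∈ univ.filter (fun s : F => s ≠ 0), ψ (-(s * t) - nrm m / (4 * s))

theorem kl_ident {F : Type} [Field F] [Fintype F] [DecidableEq F] (hF : ringChar F ≠ 2)
    (ψ : AddChar F ℂ) (hψ : ψ ≠ 1) (t : F) (z : F × F) :
    ∑ m : F × F, klW ψ t m * ψ (klDot m z) =
      ((quadraticChar F (-1) : ℤ) : ℂ) * Fintype.card F *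
        ((if nrm z = t then (Fintype.card F : ℂ) else 0) - 1) := by
  have hprim := AddChar.IsPrimitive.of_ne_one hψ
  simp only [klW, sum_mul]
  rw [sum_comm]
  have h1 : ∀ s ∈ univ.filter (fun s : F => s ≠ 0),
      ∑ m : F × F, ψ (-(s * t) - nrm m / (4 * s)) * ψ (klDot m z) =
      ((quadraticChar F (-1) : ℤ) : ℂ) * Fintype.card F * ψ (s * (nrm z - t)) := by
    intro s hs
    have := kl_gauss_plane hF ψ hψ s (mem_filter.1 hs).2 z
    rw [show s * (nrm z - t) = -(s * t) + s * nrm z by ring, AddChar.map_add_eq_mul,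
      mul_left_comm, ← this, mul_sum]
    refine sum_congr rfl fun m _ => ?_
    rw [← AddChar.map_add_eq_mul, ← AddChar.map_add_eq_mul]
    congr 1; ring
  rw [sum_congr rfl h1, ← mul_sum]
  congr 1
  have h3 := AddChar.sum_mulShift (nrm z - t) hprim
  rw [← Finset.sum_filter_add_sum_filter_not univ (fun s : F => s ≠ 0)] at h3
  have h4 : univ.filter (fun s : F => ¬ s ≠ 0) = {0} := by ext; simp
  rw [h4, sum_singleton, zero_mul, AddChar.map_zero_eq_one] at h3
  rw [eq_sub_iff_add_eq, h3]
  simp [sub_eq_zero]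

theorem klW_bound {F : Type} [Field F] [Fintype F] [DecidableEq F] 
    (ψ : AddChar F ℂ) (hψ : ψ ≠ 1) (t : F) (ht : t ≠ 0) (m : F × F) :
    ‖klW ψ t m‖ ≤ 2 * Real.sqrt (Fintype.card F) := by
  have h1 : klW ψ t m = ∑ x ∈ univ.filter (fun x : F => x ≠ 0), ψ (x + (t * nrm m / 4) / x) := by
    rw [klW]
    refine Finset.sum_nbij' (fun s => -(s * t)) (fun s => -(s / t)) ?_ ?_ ?_ ?_ ?_
    · intro s hs; simpa [ht] using hs
    · intro s hs; simpa [ht] using hs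
    · intro s _; field_simp
    · intro s _; field_simp
    · intro s hs
      have hs0 := (mem_filter.1 hs).2
      congr 1
      have : t * nrm m / 4 / -(s * t) = - (nrm m / (4 * s)) := by
        rw [div_div, mul_neg, div_neg]
        congr 1
        rw [show 4 * (s * t) = t * (4 * s) by ring, mul_div_mul_left _ _ ht]
      rw [this]; ring
  rw [h1]
  by_cases ha : t * nrm m / 4 = 0
  · simp only [ha, zero_div, add_zero]
    have h3 := AddChar.sum_eq_zero_of_ne_one hψ
    rw [← Finset.sum_filter_add_sum_filter_not univ (fun s : F => s ≠ 0)] at h3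
    have h4 : univ.filter (fun s : F => ¬ s ≠ 0) = {0} := by ext; simp
    rw [h4, sum_singleton, AddChar.map_zero_eq_one] at h3
    rw [eq_neg_of_add_eq_zero_left h3, norm_neg, norm_one]
    have : (1 : ℝ) ≤ Real.sqrt (Fintype.card F) := by
      rw [Real.one_le_sqrt]; exact_mod_cast Fintype.card_pos
    linarith
  · exact kl_weil ψ hψ _ ha

noncomputable def klHat {F : Type} [Field F] (ψ : AddChar F ℂ) (U : Finset (F × F)) (m : F × F) : ℂ :=
  ∑ u ∈ U, ψ (klDot m u)

theorem klDot_sub {F : Type} [Field F] (m u v : F × F) :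
    klDot m (u - v) = klDot m u + -klDot m v := by
  simp only [klDot, Prod.fst_sub, Prod.snd_sub]; ring

theorem kl_conj_expand {F : Type} [Field F] [Fintype F] (ψ : AddChar F ℂ) (U V : Finset (F × F))
    (m : F × F) : klHat ψ U m * (starRingEnd ℂ) (klHat ψ V m) =
      ∑ u ∈ U, ∑ v ∈ V, ψ (klDot m (u - v)) := by
  rw [klHat, klHat, map_sum, sum_mul_sum]
  refine sum_congr rfl fun u _ => sum_congr rfl fun v _ => ?_
  rw [klDot_sub, AddChar.map_add_eq_mul, AddChar.map_neg_eq_conj]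

theorem kl_parseval {F : Type} [Field F] [Fintype F] [DecidableEq F]
    (ψ : AddChar F ℂ) (hψ : ψ ≠ 1) (U : Finset (F × F)) :
    ∑ m : F × F, ‖klHat ψ U m‖ ^ 2 = (Fintype.card F : ℝ) ^ 2 * #U := by
  have hprim := AddChar.IsPrimitive.of_ne_one hψ
  have hsum : ∀ z : F × F, ∑ m : F × F, ψ (klDot m z) =
      if z = 0 then (Fintype.card F : ℂ) ^ 2 else 0 := by
    intro z
    simp only [klDot, AddChar.map_add_eq_mul]
    rw [← univ_product_univ, sum_product]
    dsimp only
    rw [← Fintype.sum_mul_sum, AddChar.sum_mulShift _ hprim, AddChar.sum_mulShift _ hprim]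
    by_cases h1 : z.1 = 0 <;> by_cases h2 : z.2 = 0 <;> simp [h1, h2, Prod.ext_iff, sq]
  have : ((∑ m : F × F, ‖klHat ψ U m‖ ^ 2 : ℝ) : ℂ) = (Fintype.card F : ℂ) ^ 2 * #U := by
    push_cast
    simp only [← Complex.mul_conj', kl_conj_expand]
    rw [sum_comm]
    have : ∀ u ∈ U, ∑ m : F × F, ∑ v ∈ U, ψ (klDot m (u - v)) = (Fintype.card F : ℂ) ^ 2 := by
      intro u hu
      rw [sum_comm]
      simp only [hsum, sub_eq_zero]
      rw [sum_ite_eq, if_pos hu]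
    rw [sum_congr rfl this, sum_const, nsmul_eq_mul, mul_comm]
  exact_mod_cast this

theorem unit_distance_bound
    {F : Type} [Field F] [Fintype F] [DecidableEq F]
    (hq : Odd (Fintype.card F)) (t : F) (ht : t ≠ 0)
    (U V : Finset (F × F)) :
    |(nDist t U V : ℝ) - (U.card : ℝ) * V.card / (Fintype.card F : ℝ)| ≤
      2 * Real.sqrt (Fintype.card F) * Real.sqrt ((U.card : ℝ) * V.card) := by
  have hF : ringChar F ≠ 2 := fun h =>
    (Nat.not_even_iff_odd.2 hq) (Nat.even_iff.2 (FiniteField.even_card_of_char_two h))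
  obtain ⟨ψ, hψ1⟩ := (AddChar.exists_apply_ne_zero (a := (1 : F))).2 one_ne_zero
  have hψ : ψ ≠ 1 := AddChar.ne_one_iff.2 ⟨1, hψ1⟩
  have hqpos : (0 : ℝ) < Fintype.card F := by exact_mod_cast Fintype.card_pos
  set q : ℝ := (Fintype.card F : ℝ) with hqdef
  set c : ℂ := ((quadraticChar F (-1) : ℤ) : ℂ) with hc
  have hcn : ‖c‖ = 1 := by
    rcases quadraticChar_dichotomy (F := F) (a := -1) (neg_ne_zero.2 one_ne_zero) with h | h <;>
      simp [hc, h]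
  have hN : (nDist t U V : ℂ) = ∑ u ∈ U, ∑ v ∈ V, if nrm (u - v) = t then (1 : ℂ) else 0 := by
    rw [nDist, card_filter, ← sum_product']
    push_cast
    rfl
  have hmain : ∑ m : F × F, klW ψ t m * (klHat ψ U m * (starRingEnd ℂ) (klHat ψ V m)) =
      c * q * (q * nDist t U V - #U * #V) := by
    simp only [kl_conj_expand, mul_sum]
    rw [sum_comm]
    have : ∀ u ∈ U, ∑ m : F × F, ∑ v ∈ V, klW ψ t m * ψ (klDot m (u - v)) =
        ∑ v ∈ V, c * q * (q * (if nrm (u - v) = t then (1 : ℂ) else 0) - 1) := by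
      intro u _
      rw [sum_comm]
      refine sum_congr rfl fun v _ => ?_
      rw [kl_ident hF ψ hψ]
      simp [hc, hqdef]
    rw [sum_congr rfl this, hN]
    simp only [← mul_sum, sum_sub_distrib, sum_const, nsmul_eq_mul, mul_one]
  have hcs : ∑ m : F × F, ‖klHat ψ U m‖ * ‖klHat ψ V m‖ ≤ q ^ 2 * Real.sqrt ((#U : ℝ) * #V) := by
    refine le_trans (Real.sum_mul_le_sqrt_mul_sqrt _ _ _) (le_of_eq ?_)
    rw [kl_parseval ψ hψ, kl_parseval ψ hψ, ← Real.sqrt_mul (by positivity),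
      show q ^ 2 * (#U : ℝ) * (q ^ 2 * #V) = (q ^ 2) ^ 2 * (#U * #V) by ring,
      Real.sqrt_mul (by positivity), Real.sqrt_sq (by positivity)]
  have hup : ‖∑ m : F × F, klW ψ t m * (klHat ψ U m * (starRingEnd ℂ) (klHat ψ V m))‖ ≤
      2 * Real.sqrt q * (q ^ 2 * Real.sqrt ((#U : ℝ) * #V)) := by
    refine le_trans (norm_sum_le _ _) ?_
    refine le_trans (sum_le_sum (g := fun m => 2 * Real.sqrt q * (‖klHat ψ U m‖ * ‖klHat ψ V m‖)) ?_) ?_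
    · intro m _
      rw [norm_mul, norm_mul, RCLike.norm_conj]
      exact mul_le_mul_of_nonneg_right (klW_bound ψ hψ t ht m) (by positivity)
    · rw [← mul_sum]
      exact mul_le_mul_of_nonneg_left hcs (by positivity)
  have hreal : ((q : ℂ) * nDist t U V - #U * #V) = ((q * nDist t U V - #U * #V : ℝ) : ℂ) := by
    push_cast; rfl
  rw [hmain, norm_mul, norm_mul, hcn, one_mul, hreal, Complex.norm_real, Complex.norm_real,
    Real.norm_of_nonneg hqpos.le, Real.norm_eq_abs] at hup
  have hfin : q * |q * nDist t U V - #U * #V| =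
      q ^ 2 * |(nDist t U V : ℝ) - (#U : ℝ) * #V / q| := by
    rw [show q * (nDist t U V : ℝ) - #U * #V = q * ((nDist t U V : ℝ) - (#U : ℝ) * #V / q) by
      field_simp, abs_mul, abs_of_pos hqpos]
    ring
  rw [hfin] at hup
  have hq2 : 0 < q ^ 2 := by positivity
  refine le_of_mul_le_mul_left (le_trans hup (le_of_eq (by ring))) hq2
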